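/- (Part (3) of the key lattice lemma, type E.) In the negative-definite root lattice of type E_6: if e_i^∨ lies in ℤ^6 and i ≠ 1, then ⟨ι(e_i^∨), e_i^∨⟩ < −9/2, where ι is the isometry of ℚ^6 with ι(e_1) = e_1 and ι(e_j) = e_{8−j} for 2 ≤ j ≤ 6. In the negative-definite root lattice of type E_7: if e_i^∨ lies in ℤ^7 and i ∉ {2,4,6}, then ⟨e_i^∨, e_i^∨⟩ < −9/2. In the negative-definite root lattice of type E_8: if e_i^∨ lies in ℤ^8 and i ∉ {2,4,6,8}, then ⟨e_i^∨, e_i^∨⟩ < −9/2. -/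

import Mathlib

open Finset

/-- Negated Cartan matrix of the root lattice of type `E_n` for `n ∈ {6,7,8}`
(indices `0,…,n-1` correspond to `e_1,…,e_n`; the Dynkin diagram is the chain
`e_2—e_3—⋯—e_n` with `e_1` attached to `e_4`). -/
def cartanE (n : ℕ) (i j : Fin n) : ℚ :=
  if i = j then -2
  else if ((i : ℕ) = 0 ∧ (j : ℕ) = 3) ∨ ((i : ℕ) = 3 ∧ (j : ℕ) = 0) then 1
  else if (((i : ℕ) + 1 = (j : ℕ) ∨ (j : ℕ) + 1 = (i : ℕ)) ∧ 1 ≤ (i : ℕ) ∧ 1 ≤ (j : ℕ))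
    then 1 else 0

/-- The symmetric bilinear form of the negative-definite root lattice of type `E_n`. -/
def bilinE (n : ℕ) (x y : Fin n → ℚ) : ℚ :=
  ∑ i, ∑ j, x i * cartanE n i j * y j

/-- The standard basis vector `e_j`. -/
def eE (n : ℕ) (j : Fin n) : Fin n → ℚ := fun k => if k = j then 1 else 0

/-- `v` is the dual basis vector `e_i^∨`, i.e. `⟨v, e_k⟩ = δ_{ik}` for all `k`. -/
def IsDualE (n : ℕ) (v : Fin n → ℚ) (i : Fin n) : Prop :=
  ∀ k : Fin n, bilinE n v (eE n k) = if k = i then 1 else 0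

/-- The index permutation of the Dynkin diagram involution `ι` of type `E_6`:
`ι(e_1) = e_1` and `ι(e_i) = e_{8−i}` for `2 ≤ i ≤ 6` (0-based: `0↦0`, `k↦6−k`). -/
def iotaE6 : Fin 6 → Fin 6 := ![0, 5, 4, 3, 2, 1]

theorem bilinE_eE (n : ℕ) (v : Fin n → ℚ) (k : Fin n) :
    bilinE n v (eE n k) = ∑ j, v j * cartanE n j k := by
  simp [bilinE, eE]

theorem cartanE_comm (n : ℕ) (i j : Fin n) : cartanE n i j = cartanE n j i := by
  unfold cartanE
  grind

theorem bilinE_comm (n : ℕ) (x y : Fin n → ℚ) : bilinE n x y = bilinE n y x := by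
  unfold bilinE
  rw [Finset.sum_comm]
  refine Finset.sum_congr rfl fun i _ => Finset.sum_congr rfl fun j _ => ?_
  rw [cartanE_comm n j i]
  ring

/-- Pairing with `e_i^∨` reads off the `i`-th coordinate. -/
theorem IsDualE.bilinE_eq {n : ℕ} {v : Fin n → ℚ} {i : Fin n} (h : IsDualE n v i)
    (w : Fin n → ℚ) : bilinE n v w = w i := by
  calc bilinE n v w = ∑ k, bilinE n v (eE n k) * w k := by
        simp only [bilinE_eE, Finset.sum_mul]
        rw [Finset.sum_comm]
        rfl
    _ = w i := by simp [h _]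

/-- A rational number represented by an integer `≤ -5` is less than `-9/2`. -/
theorem intCast_lt_neg_nine_halves {a : ℤ} (h : a ≤ -5) : (a : ℚ) < -9 / 2 := by
  have : (a : ℚ) ≤ -5 := by exact_mod_cast h
  linarith

/-- The integer form of the Cartan matrix. -/
def cartanEInt (n : ℕ) (i j : Fin n) : ℤ :=
  if i = j then -2
  else if ((i : ℕ) = 0 ∧ (j : ℕ) = 3) ∨ ((i : ℕ) = 3 ∧ (j : ℕ) = 0) then 1
  else if (((i : ℕ) + 1 = (j : ℕ) ∨ (j : ℕ) + 1 = (i : ℕ)) ∧ 1 ≤ (i : ℕ) ∧ 1 ≤ (j : ℕ))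
    then 1 else 0

theorem cartanEInt_cast (n : ℕ) (i j : Fin n) : (cartanEInt n i j : ℚ) = cartanE n i j := by
  unfold cartanEInt cartanE
  split_ifs <;> simp

/-- The defining equations of an integral dual vector, over `ℤ`. -/
theorem IsDualE.int_eq {n : ℕ} {a : Fin n → ℤ} {i : Fin n}
    (h : IsDualE n (fun k => (a k : ℚ)) i) (k : Fin n) :
    ∑ j, a j * cartanEInt n j k = if k = i then 1 else 0 := by
  have hk := h k
  simp only [bilinE_eE, ← cartanEInt_cast] at hk
  exact_mod_cast hk

/-- Part (3) of the key lattice lemma, type `E`.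
`E_6`: if `e_i^∨ ∈ ℤ^6` and `i ≠ 1` then `⟨ι(e_i^∨), e_i^∨⟩ < −9/2`.
`E_7`: if `e_i^∨ ∈ ℤ^7` and `i ∉ {2,4,6}` then `⟨e_i^∨, e_i^∨⟩ < −9/2`.
`E_8`: if `e_i^∨ ∈ ℤ^8` and `i ∉ {2,4,6,8}` then `⟨e_i^∨, e_i^∨⟩ < −9/2`. -/
theorem dual_integral_pairing_lt_E :
    (∀ (i : Fin 6) (v : Fin 6 → ℚ), IsDualE 6 v i →
      (∀ k, ∃ a : ℤ, v k = (a : ℚ)) → (i : ℕ) + 1 ≠ 1 →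
      bilinE 6 (fun k => v (iotaE6 k)) v < -9 / 2) ∧
    (∀ (i : Fin 7) (v : Fin 7 → ℚ), IsDualE 7 v i →
      (∀ k, ∃ a : ℤ, v k = (a : ℚ)) → (i : ℕ) + 1 ∉ ({2, 4, 6} : Set ℕ) →
      bilinE 7 v v < -9 / 2) ∧
    (∀ (i : Fin 8) (v : Fin 8 → ℚ), IsDualE 8 v i →
      (∀ k, ∃ a : ℤ, v k = (a : ℚ)) → (i : ℕ) + 1 ∉ ({2, 4, 6, 8} : Set ℕ) →
      bilinE 8 v v < -9 / 2) := by
  refine ⟨?_, ?_, ?_⟩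
  · intro i v hv h_int hi
    choose a ha using h_int
    obtain rfl : v = fun k => (a k : ℚ) := funext ha
    rw [bilinE_comm, hv.bilinE_eq]
    apply intCast_lt_neg_nine_halves
    have h0 := hv.int_eq 0
    have h1 := hv.int_eq 1
    have h2 := hv.int_eq 2
    have h3 := hv.int_eq 3
    have h4 := hv.int_eq 4
    have h5 := hv.int_eq 5
    clear hv ha
    fin_cases i <;>
      simp [Fin.sum_univ_six, cartanEInt, iotaE6] at h0 h1 h2 h3 h4 h5 hi ⊢ <;> omega
  · intro i v hv h_int hi
    choose a ha using h_int
    obtain rfl : v = fun k => (a k : ℚ) := funext ha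
    rw [hv.bilinE_eq]
    apply intCast_lt_neg_nine_halves
    have h0 := hv.int_eq 0
    have h1 := hv.int_eq 1
    have h2 := hv.int_eq 2
    have h3 := hv.int_eq 3
    have h4 := hv.int_eq 4
    have h5 := hv.int_eq 5
    have h6 := hv.int_eq 6
    clear hv ha
    fin_cases i <;>
      simp [Fin.sum_univ_seven, cartanEInt] at h0 h1 h2 h3 h4 h5 h6 hi ⊢ <;> omega
  · intro i v hv h_int hi
    choose a ha using h_int
    obtain rfl : v = fun k => (a k : ℚ) := funext ha
    rw [hv.bilinE_eq]
    apply intCast_lt_neg_nine_halves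
    have h0 := hv.int_eq 0
    have h1 := hv.int_eq 1
    have h2 := hv.int_eq 2
    have h3 := hv.int_eq 3
    have h4 := hv.int_eq 4
    have h5 := hv.int_eq 5
    have h6 := hv.int_eq 6
    have h7 := hv.int_eq 7
    clear hv ha
    fin_cases i <;>
      simp [Fin.sum_univ_eight, cartanEInt] at h0 h1 h2 h3 h4 h5 h6 h7 hi ⊢ <;> omega
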